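/- For every r ∈ (0,1) there exists a unique p ∈ (0,1) such that 1 − 2·E(p)/K(p) = r. -/

import Mathlib

/-- Complete elliptic integral of the first kind. -/
noncomputable def ellipticK (p : ℝ) : ℝ :=
  ∫ z in (0:ℝ)..1, 1 / (Real.sqrt (1 - z ^ 2) * Real.sqrt (1 - p ^ 2 * z ^ 2))

/-- Complete elliptic integral of the second kind. -/
noncomputable def ellipticE (p : ℝ) : ℝ :=
  ∫ z in (0:ℝ)..1, Real.sqrt (1 - p ^ 2 * z ^ 2) / Real.sqrt (1 - z ^ 2)

open Set Real MeasureTheory intervalIntegral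

lemma intervalIntegrable_inv_sqrt_one_sub_sq :
    IntervalIntegrable (fun z : ℝ => (√(1 - z ^ 2))⁻¹) volume 0 1 := by
  rw [intervalIntegrable_iff_integrableOn_Ioc_of_le zero_le_one]
  refine integrableOn_deriv_of_nonneg (g := arcsin) continuous_arcsin.continuousOn
    (fun x hx => ?_) (fun x _ => by positivity)
  have h := hasDerivAt_arcsin (x := x) (by linarith [hx.1]) (by linarith [hx.2])
  rwa [one_div] at h

lemma one_sub_sq_mul_sq_pos {p z : ℝ} (hp : p ∈ Ico (0 : ℝ) 1) (hz : z ∈ Icc (0 : ℝ) 1) :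
    0 < 1 - p ^ 2 * z ^ 2 := by
  have h : p * z ≤ p := mul_le_of_le_one_right hp.1 hz.2
  have h' : 0 ≤ p * z := mul_nonneg hp.1 hz.1
  nlinarith [hp.2]

lemma ellipticK_eq (p : ℝ) :
    ellipticK p = ∫ z in (0 : ℝ)..1, (√(1 - z ^ 2))⁻¹ * (√(1 - p ^ 2 * z ^ 2))⁻¹ := by
  simp only [ellipticK, one_div, mul_inv]

lemma ellipticE_eq (p : ℝ) :
    ellipticE p = ∫ z in (0 : ℝ)..1, (√(1 - z ^ 2))⁻¹ * √(1 - p ^ 2 * z ^ 2) := by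
  simp only [ellipticE, div_eq_inv_mul]

lemma intervalIntegrable_ellipticK {p : ℝ} (hp : p ∈ Ico (0 : ℝ) 1) :
    IntervalIntegrable (fun z : ℝ => (√(1 - z ^ 2))⁻¹ * (√(1 - p ^ 2 * z ^ 2))⁻¹) volume 0 1 := by
  refine intervalIntegrable_inv_sqrt_one_sub_sq.mul_continuousOn ?_
  refine ContinuousOn.inv₀ (by fun_prop) fun z hz => ?_
  rw [uIcc_of_le zero_le_one] at hz
  exact (sqrt_pos.2 (one_sub_sq_mul_sq_pos hp hz)).ne'

lemma intervalIntegrable_ellipticE (p : ℝ) :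
    IntervalIntegrable (fun z : ℝ => (√(1 - z ^ 2))⁻¹ * √(1 - p ^ 2 * z ^ 2)) volume 0 1 :=
  intervalIntegrable_inv_sqrt_one_sub_sq.mul_continuousOn (by fun_prop)

lemma inv_sqrt_one_sub_sq_pos {z : ℝ} (hz : z ∈ Ioo (0 : ℝ) 1) : 0 < (√(1 - z ^ 2))⁻¹ :=
  inv_pos.2 (sqrt_pos.2 (by nlinarith [hz.1, hz.2]))

lemma ellipticK_pos {p : ℝ} (hp : p ∈ Ico (0 : ℝ) 1) : 0 < ellipticK p := by
  rw [ellipticK_eq]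
  refine intervalIntegral_pos_of_pos_on (intervalIntegrable_ellipticK hp) (fun z hz => ?_)
    zero_lt_one
  exact mul_pos (inv_sqrt_one_sub_sq_pos hz)
    (inv_pos.2 (sqrt_pos.2 (one_sub_sq_mul_sq_pos hp (Ioo_subset_Icc_self hz))))

lemma ellipticE_pos {p : ℝ} (hp : p ∈ Ico (0 : ℝ) 1) : 0 < ellipticE p := by
  rw [ellipticE_eq]
  refine intervalIntegral_pos_of_pos_on (intervalIntegrable_ellipticE p) (fun z hz => ?_)
    zero_lt_one
  exact mul_pos (inv_sqrt_one_sub_sq_pos hz)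
    (sqrt_pos.2 (one_sub_sq_mul_sq_pos hp (Ioo_subset_Icc_self hz)))

lemma ellipticK_strictMonoOn : StrictMonoOn ellipticK (Ico 0 1) := by
  intro p hp q hq hpq
  rw [← sub_pos, ellipticK_eq, ellipticK_eq, ← integral_sub
    (intervalIntegrable_ellipticK hq) (intervalIntegrable_ellipticK hp)]
  refine intervalIntegral_pos_of_pos_on
    ((intervalIntegrable_ellipticK hq).sub (intervalIntegrable_ellipticK hp)) (fun z hz => ?_)
    zero_lt_one
  have hz' := Ioo_subset_Icc_self hz
  have hsq : p ^ 2 < q ^ 2 := pow_lt_pow_left₀ hpq hp.1 two_ne_zero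
  have hlt : p ^ 2 * z ^ 2 < q ^ 2 * z ^ 2 := mul_lt_mul_of_pos_right hsq (pow_pos hz.1 2)
  have hinv : (√(1 - p ^ 2 * z ^ 2))⁻¹ < (√(1 - q ^ 2 * z ^ 2))⁻¹ :=
    inv_strictAnti₀ (sqrt_pos.2 (one_sub_sq_mul_sq_pos hq hz'))
      (sqrt_lt_sqrt (one_sub_sq_mul_sq_pos hq hz').le (by linarith))
  exact sub_pos.2 (mul_lt_mul_of_pos_left hinv (inv_sqrt_one_sub_sq_pos hz))

lemma ellipticE_antitoneOn : AntitoneOn ellipticE (Ici 0) := by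
  intro p hp q _ hpq
  rw [ellipticE_eq, ellipticE_eq]
  refine integral_mono_on zero_le_one (intervalIntegrable_ellipticE q)
    (intervalIntegrable_ellipticE p) fun z _ => ?_
  have hsq : p ^ 2 ≤ q ^ 2 := pow_le_pow_left₀ hp hpq 2
  gcongr

lemma continuousOn_ellipticE : ContinuousOn ellipticE (Ici 0) := by
  intro p _
  have h : ContinuousAt
      (fun p => ∫ z in (0 : ℝ)..1, (√(1 - z ^ 2))⁻¹ * √(1 - p ^ 2 * z ^ 2)) p := by
    refine continuousAt_of_dominated_interval (bound := fun z => (√(1 - z ^ 2))⁻¹) ?_ ?_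
      intervalIntegrable_inv_sqrt_one_sub_sq ?_
    · exact .of_forall fun q => (by fun_prop : Measurable _).aestronglyMeasurable
    · refine .of_forall fun q => .of_forall fun z _ => ?_
      rw [norm_of_nonneg (by positivity)]
      exact mul_le_of_le_one_right (by positivity)
        (sqrt_le_one.2 (by nlinarith [mul_nonneg (sq_nonneg q) (sq_nonneg z)]))
    · exact .of_forall fun z _ => by fun_prop
  exact (h.congr (.of_forall fun q => (ellipticE_eq q).symm)).continuousWithinAt

lemma continuousOn_ellipticK {q : ℝ} (hq : q ∈ Ico (0 : ℝ) 1) :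
    ContinuousOn ellipticK (Icc 0 q) := by
  intro p hp
  have h : ContinuousWithinAt
      (fun p => ∫ z in (0 : ℝ)..1, (√(1 - z ^ 2))⁻¹ * (√(1 - p ^ 2 * z ^ 2))⁻¹) (Icc 0 q) p := by
    refine continuousWithinAt_of_dominated_interval
      (bound := fun z => (√(1 - z ^ 2))⁻¹ * (√(1 - q ^ 2 * z ^ 2))⁻¹) ?_ ?_
      (intervalIntegrable_ellipticK hq) ?_
    · exact .of_forall fun q => (by fun_prop : Measurable _).aestronglyMeasurable
    · filter_upwards [self_mem_nhdsWithin] with s hs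
      refine .of_forall fun z hz => ?_
      rw [uIoc_of_le zero_le_one] at hz
      have hpos := sqrt_pos.2 (one_sub_sq_mul_sq_pos hq (Ioc_subset_Icc_self hz))
      have hsq : s ^ 2 ≤ q ^ 2 := pow_le_pow_left₀ hs.1 hs.2 2
      rw [norm_of_nonneg (by positivity)]
      gcongr
    · refine .of_forall fun z hz => ContinuousAt.continuousWithinAt ?_
      rw [uIoc_of_le zero_le_one] at hz
      have hpos := sqrt_pos.2 (one_sub_sq_mul_sq_pos ⟨hp.1, hp.2.trans_lt hq.2⟩
        (Ioc_subset_Icc_self hz))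
      exact continuousAt_const.mul (ContinuousAt.inv₀ (by fun_prop) hpos.ne')
  exact h.congr (fun s _ => ellipticK_eq s) (ellipticK_eq p)

lemma neg_log_one_sub_div_two_le_ellipticK {q : ℝ} (hq : q ∈ Ico (0 : ℝ) 1) :
    -log (1 - q) / 2 ≤ ellipticK q := by
  have hpos : ∀ z ∈ Icc (0 : ℝ) 1, 0 < 1 - q * z := fun z hz => by
    nlinarith [mul_le_of_le_one_right hq.1 hz.2, hq.2]
  have hintegrable : IntervalIntegrable (fun z => q / (2 * (1 - q * z))) volume 0 1 := by
    refine ContinuousOn.intervalIntegrable (ContinuousOn.div (by fun_prop) (by fun_prop) ?_)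
    intro z hz
    rw [uIcc_of_le zero_le_one] at hz
    linarith [hpos z hz]
  have hftc : ∫ z in (0 : ℝ)..1, q / (2 * (1 - q * z)) = -log (1 - q) / 2 := by
    rw [integral_eq_sub_of_hasDerivAt (f := fun z => -log (1 - q * z) / 2) _ hintegrable]
    · simp
    · intro z hz
      rw [uIcc_of_le zero_le_one] at hz
      have hne := (hpos z hz).ne'
      have h := (((((hasDerivAt_id z).const_mul q).const_sub 1).log hne).neg).div_const 2
      refine h.congr_deriv ?_
      simp only [id]
      field_simp
  rw [← hftc, ellipticK_eq]
  refine integral_mono_on_of_le_Ioo zero_le_one hintegrable (intervalIntegrable_ellipticK hq)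
    fun z hz => ?_
  have hz' := Ioo_subset_Icc_self hz
  have hq2 := one_sub_sq_mul_sq_pos hq hz'
  have hz2 : 0 < 1 - z ^ 2 := by nlinarith [hz.1, hz.2]
  have hqz := hpos z hz'
  have hle : √(1 - z ^ 2) * √(1 - q ^ 2 * z ^ 2) ≤ 2 * (1 - q * z) := by
    calc √(1 - z ^ 2) * √(1 - q ^ 2 * z ^ 2)
        ≤ √(1 - q ^ 2 * z ^ 2) * √(1 - q ^ 2 * z ^ 2) := by
          gcongr
          exact mul_le_of_le_one_left (sq_nonneg z) (pow_le_one₀ hq.1 hq.2.le)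
      _ = (1 - q * z) * (1 + q * z) := by rw [mul_self_sqrt hq2.le]; ring
      _ ≤ 2 * (1 - q * z) := by nlinarith
  rw [← mul_inv, ← one_div]
  exact div_le_div₀ zero_le_one hq.2.le (mul_pos (sqrt_pos.2 hz2) (sqrt_pos.2 hq2)) hle

lemma exists_lt_ellipticK (M : ℝ) : ∃ q ∈ Ioo (0 : ℝ) 1, M < ellipticK q := by
  have hexp : exp (-(2 * (|M| + 1))) < 1 := exp_lt_one_iff.2 (by linarith [abs_nonneg M])
  have hq : 1 - exp (-(2 * (|M| + 1))) ∈ Ioo (0 : ℝ) 1 :=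
    ⟨by linarith, by linarith [exp_pos (-(2 * (|M| + 1)))]⟩
  refine ⟨_, hq, ?_⟩
  have h := neg_log_one_sub_div_two_le_ellipticK (Ioo_subset_Ico_self hq)
  rw [sub_sub_cancel, log_exp] at h
  linarith [le_abs_self M]

lemma strictMonoOn_one_sub_two_mul_ellipticE_div_ellipticK :
    StrictMonoOn (fun p => 1 - 2 * ellipticE p / ellipticK p) (Ico 0 1) := by
  intro p hp q hq hpq
  have hE := ellipticE_antitoneOn hp.1 hq.1 hpq.le
  have hlt : 2 * ellipticE q / ellipticK q < 2 * ellipticE p / ellipticK p :=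
    div_lt_div₀' (by linarith) (ellipticK_strictMonoOn hp hq hpq)
      (by linarith [ellipticE_pos hp]) (ellipticK_pos hp)
  simpa using hlt

theorem existsUnique_p_check {r : ℝ} (hr : r ∈ Set.Ioo (0:ℝ) 1) :
    ∃! p : ℝ, p ∈ Set.Ioo (0:ℝ) 1 ∧ 1 - 2 * ellipticE p / ellipticK p = r := by
  have h0 : (0 : ℝ) ∈ Ico (0 : ℝ) 1 := ⟨le_rfl, zero_lt_one⟩
  have hr1 : 0 < 1 - r := by linarith [hr.2]
  obtain ⟨q, hq, hK⟩ := exists_lt_ellipticK (2 * ellipticE 0 / (1 - r))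
  have hq' := Ioo_subset_Ico_self hq
  have hcont : ContinuousOn (fun p => 1 - 2 * ellipticE p / ellipticK p) (Icc 0 q) :=
    continuousOn_const.sub ((continuousOn_const.mul
      (continuousOn_ellipticE.mono Icc_subset_Ici_self)).div (continuousOn_ellipticK hq')
        fun p hp => (ellipticK_pos ⟨hp.1, hp.2.trans_lt hq.2⟩).ne')
  have hleft : 1 - 2 * ellipticE 0 / ellipticK 0 < r := by
    have heq : ellipticE 0 = ellipticK 0 := by simp [ellipticE_eq, ellipticK_eq]
    rw [heq, mul_div_cancel_right₀ _ (ellipticK_pos h0).ne']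
    linarith [hr.1]
  have hright : r < 1 - 2 * ellipticE q / ellipticK q := by
    have hE := ellipticE_antitoneOn h0.1 hq'.1 hq.1.le
    rw [div_lt_iff₀ hr1] at hK
    have hlt : 2 * ellipticE q / ellipticK q < 1 - r := by
      rw [div_lt_iff₀ (ellipticK_pos hq')]
      linarith
    linarith
  obtain ⟨p, hp, hpr⟩ := intermediate_value_Ioo hq.1.le hcont ⟨hleft, hright⟩
  refine ⟨p, ⟨⟨hp.1, hp.2.trans hq.2⟩, hpr⟩, fun s hs => ?_⟩
  exact strictMonoOn_one_sub_two_mul_ellipticE_div_ellipticK.injOn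
    (Ioo_subset_Ico_self hs.1) ⟨hp.1.le, hp.2.trans hq.2⟩ (hs.2.trans hpr.symm)
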